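/- Let u, p, w, m, φ be smooth (C^∞) functions on [0,t_F] × cl(Ω) with values in ℝ³, ℝ, ℝ³, ℝ³, ℝ respectively, and let h_a : [0,t_F] × cl(Ω) → ℝ³ be smooth. Set h(t,x) := ∇_x φ(t,x). Assume: (a) u(t,·) = 0 and w(t,·) = 0 on ∂Ω for every t; (b) div u = 0 in Ω; (c) pointwise in (0,t_F) × Ω the Rosensweig system with σ = 0 holds: u_t + (u·∇)u − (ν+ν_r)Δu + ∇p = 2ν_r curl w + μ₀ (m·∇)h; ȷ w_t + ȷ (u·∇)w − c₁ Δw − c₂ ∇(div w) + 4ν_r w = 2ν_r curl u + μ₀ m × h; m_t + (u·∇)m = w × m − (1/𝒯)(m − κ₀ h); (d) for every t ∈ [0,t_F] and every smooth χ : cl(Ω) → ℝ, ∫_Ω ∇φ(t)·∇χ dx = ∫_Ω (h_a(t) − m(t))·∇χ dx. Define 𝓔(s) := ½(‖u(s)‖² + ȷ‖w(s)‖² + μ₀‖m(s)‖² + μ₀‖h(s)‖²), 𝓓(s) := ν‖∇u(s)‖² + c₁‖∇w(s)‖² + c₂‖div w(s)‖² + ν_r‖curl u(s) − 2w(s)‖²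 + (μ₀/𝒯)‖m(s)‖² + (μ₀/(2𝒯))(1/2 + 3κ₀)‖h(s)‖², and 𝓕(s) := 𝒯 μ₀ ‖∂_t h_a(s)‖² + (μ₀/(2𝒯))(1+κ₀)‖h_a(s)‖². Then the energy estimate 𝓔(t_F) + ∫₀^{t_F} 𝓓(s) ds ≤ ∫₀^{t_F} 𝓕(s) ds + 𝓔(0) holds. -/

import Mathlib

open MeasureTheory Set
open scoped RealInnerProductSpace

noncomputable section

abbrev E3 : Type := EuclideanSpace ℝ (Fin 3)

/-- The partial derivative `∂f/∂x_i` of a scalar function. -/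
def pdS (f : E3 → ℝ) (i : Fin 3) (x : E3) : ℝ :=
  fderiv ℝ f x (EuclideanSpace.single i 1)

/-- The Laplacian `Δf = ∑_i ∂²f/∂x_i²` of a scalar function. -/
def lapS (f : E3 → ℝ) (x : E3) : ℝ :=
  ∑ i, pdS (fun y => pdS f i y) i x

/-- The partial derivative `∂ f^j / ∂ x_i` of a vector field. -/
def pd (f : E3 → E3) (i j : Fin 3) (x : E3) : ℝ :=
  fderiv ℝ (fun y => f y j) x (EuclideanSpace.single i 1)

/-- The divergence of a vector field. -/
def vdiv (f : E3 → E3) (x : E3) : ℝ := ∑ i, pd f i i x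

/-- The `k`-th component of the three-dimensional curl. -/
def ccomp (f : E3 → E3) (k : Fin 3) (x : E3) : ℝ :=
  pd f (k + 1) (k + 2) x - pd f (k + 2) (k + 1) x

/-- The `k`-th component of the cross product `a × b` in ℝ³. -/
def crossc (a b : E3) (k : Fin 3) : ℝ :=
  a (k + 1) * b (k + 2) - a (k + 2) * b (k + 1)

/-- L²(Ω) inner product of vector fields. -/
def ipv (Ω : Set E3) (f g : E3 → E3) : ℝ := ∫ x in Ω, ⟪f x, g x⟫

/-- Squared L²(Ω) norm of a vector field. -/
def nsq (Ω : Set E3) (f : E3 → E3) : ℝ := ∫ x in Ω, ‖f x‖ ^ 2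

/-- Squared L²(Ω) norm of the full gradient of a vector field. -/
def gnsq (Ω : Set E3) (f : E3 → E3) : ℝ :=
  ∫ x in Ω, ∑ i, ∑ j, (pd f i j x) ^ 2

open Filter Topology

/-- The space-time cylinder `[0,T] × cl(Ω)`. -/
def cyl (T : ℝ) (Ω : Set E3) : Set (ℝ × E3) := Icc 0 T ×ˢ closure Ω

/-- The directional derivative along `v` relative to the space-time cylinder. -/
def dirD (T : ℝ) (Ω : Set E3) (v : ℝ × E3) (F : ℝ × E3 → ℝ) (q : ℝ × E3) : ℝ :=
  fderivWithin ℝ F (cyl T Ω) q v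

/-- The space-time direction of the spatial coordinate `x_i`. -/
def dx (i : Fin 3) : ℝ × E3 := (0, EuclideanSpace.single i 1)

/-- The space-time direction of the time coordinate. -/
def dt : ℝ × E3 := (1, 0)

theorem uniqueDiffOn_cyl {T : ℝ} {Ω : Set E3} (hT : 0 < T) (ho : IsOpen Ω) (hc : Convex ℝ Ω) :
    UniqueDiffOn ℝ (cyl T Ω) := by
  refine (uniqueDiffOn_Icc hT).prod ?_
  rcases Ω.eq_empty_or_nonempty with rfl | hne
  · simp [uniqueDiffOn_empty]
  · exact uniqueDiffOn_convex hc.closure (hne.mono (ho.subset_interior_iff.2 subset_closure))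

theorem isCompact_cyl {T : ℝ} {Ω : Set E3} (hb : Bornology.IsBounded Ω) :
    IsCompact (cyl T Ω) :=
  isCompact_Icc.prod hb.isCompact_closure

theorem cyl_mem_nhds {T : ℝ} {Ω : Set E3} (ho : IsOpen Ω) {t : ℝ} (ht : t ∈ Ioo 0 T)
    {x : E3} (hx : x ∈ Ω) : cyl T Ω ∈ 𝓝 (t, x) :=
  prod_mem_nhds (Icc_mem_nhds ht.1 ht.2) (mem_of_superset (ho.mem_nhds hx) subset_closure)

section Slices

variable {T : ℝ} {Ω : Set E3} {F G : ℝ × E3 → ℝ}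

theorem ContDiffOn.hasFDerivWithinAt_cyl (hF : ContDiffOn ℝ (⊤ : ℕ∞) F (cyl T Ω))
    {q : ℝ × E3} (hq : q ∈ cyl T Ω) :
    HasFDerivWithinAt F (fderivWithin ℝ F (cyl T Ω) q) (cyl T Ω) q :=
  (hF.differentiableOn (by simp) q hq).hasFDerivWithinAt

theorem ContDiffOn.dirD (hU : UniqueDiffOn ℝ (cyl T Ω)) (v : ℝ × E3)
    (hF : ContDiffOn ℝ (⊤ : ℕ∞) F (cyl T Ω)) :
    ContDiffOn ℝ (⊤ : ℕ∞) (dirD T Ω v F) (cyl T Ω) :=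
  (hF.fderivWithin hU (by simp)).clm_apply contDiffOn_const

theorem dirD_mul (hU : UniqueDiffOn ℝ (cyl T Ω)) (v : ℝ × E3)
    (hF : ContDiffOn ℝ (⊤ : ℕ∞) F (cyl T Ω)) (hG : ContDiffOn ℝ (⊤ : ℕ∞) G (cyl T Ω))
    {q : ℝ × E3} (hq : q ∈ cyl T Ω) :
    dirD T Ω v (fun q => F q * G q) q = dirD T Ω v F q * G q + F q * dirD T Ω v G q := by
  have h := ((hF.hasFDerivWithinAt_cyl hq).fun_mul (hG.hasFDerivWithinAt_cyl hq)).fderivWithin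
    (hU q hq)
  simp only [dirD]
  rw [h]
  simp
  ring

theorem dirD_sum (hU : UniqueDiffOn ℝ (cyl T Ω)) (v : ℝ × E3) {F : Fin 3 → ℝ × E3 → ℝ}
    (hF : ∀ j, ContDiffOn ℝ (⊤ : ℕ∞) (F j) (cyl T Ω)) {q : ℝ × E3} (hq : q ∈ cyl T Ω) :
    dirD T Ω v (fun q => ∑ j, F j q) q = ∑ j, dirD T Ω v (F j) q := by
  have h := (HasFDerivWithinAt.fun_sum (u := Finset.univ)
    fun j _ => (hF j).hasFDerivWithinAt_cyl hq).fderivWithin (hU q hq)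
  simp only [dirD]
  rw [h]
  simp

theorem dirD_comm (ho : IsOpen Ω) (v v' : ℝ × E3)
    (hF : ContDiffOn ℝ (⊤ : ℕ∞) F (cyl T Ω)) {t : ℝ} (ht : t ∈ Ioo 0 T) {x : E3} (hx : x ∈ Ω) :
    dirD T Ω v (dirD T Ω v' F) (t, x) = dirD T Ω v' (dirD T Ω v F) (t, x) := by
  have hK := cyl_mem_nhds ho ht hx
  have hF' := hF.contDiffAt hK
  have key : ∀ a b : ℝ × E3, dirD T Ω a (dirD T Ω b F) (t, x) =
      fderiv ℝ (fderiv ℝ F) (t, x) a b := by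
    intro a b
    have hd : DifferentiableAt ℝ (fderiv ℝ F) (t, x) :=
      (hF'.fderiv_right (m := 1) (by norm_cast)).differentiableAt (by simp)
    have he : dirD T Ω b F =ᶠ[𝓝 (t, x)] fun q => fderiv ℝ F q b := by
      filter_upwards [eventually_mem_nhds_iff.2 hK] with q hq
      simp only [dirD]
      rw [fderivWithin_of_mem_nhds hq]
    rw [dirD, fderivWithin_of_mem_nhds hK, he.fderiv_eq]
    rw [fderiv_clm_apply hd (differentiableAt_const _)]
    simp
  rw [key, key]
  exact (hF'.isSymmSndFDerivAt (by simp; norm_cast)) v v'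

theorem hasFDerivAt_slice (ho : IsOpen Ω) (hF : ContDiffOn ℝ (⊤ : ℕ∞) F (cyl T Ω))
    {t : ℝ} (ht : t ∈ Icc 0 T) {x : E3} (hx : x ∈ Ω) :
    HasFDerivAt (fun y => F (t, y))
      ((fderivWithin ℝ F (cyl T Ω) (t, x)).comp (ContinuousLinearMap.inr ℝ ℝ E3)) x := by
  have h1 := hF.hasFDerivWithinAt_cyl (q := (t, x)) ⟨ht, subset_closure hx⟩
  have h2 : HasFDerivWithinAt (fun y : E3 => (t, y)) (ContinuousLinearMap.inr ℝ ℝ E3) Ω x :=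
    (hasFDerivAt_prodMk_right t x).hasFDerivWithinAt
  exact (h1.comp x h2 fun y hy => ⟨ht, subset_closure hy⟩).hasFDerivAt (ho.mem_nhds hx)

theorem pdS_slice (ho : IsOpen Ω) (hF : ContDiffOn ℝ (⊤ : ℕ∞) F (cyl T Ω))
    {t : ℝ} (ht : t ∈ Icc 0 T) {x : E3} (hx : x ∈ Ω) (i : Fin 3) :
    pdS (fun y => F (t, y)) i x = dirD T Ω (dx i) F (t, x) := by
  rw [pdS, (hasFDerivAt_slice ho hF ht hx).fderiv]
  rfl

theorem hasDerivAt_slice (hF : ContDiffOn ℝ (⊤ : ℕ∞) F (cyl T Ω))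
    {t : ℝ} (ht : t ∈ Ioo 0 T) {x : E3} (hx : x ∈ closure Ω) :
    HasDerivAt (fun s => F (s, x)) (dirD T Ω dt F (t, x)) t := by
  have h1 := hF.hasFDerivWithinAt_cyl (q := (t, x)) ⟨Ioo_subset_Icc_self ht, hx⟩
  have h2 : HasFDerivWithinAt (fun s : ℝ => (s, x)) (ContinuousLinearMap.inl ℝ ℝ E3)
      (Icc 0 T) t := (hasFDerivAt_prodMk_left t x).hasFDerivWithinAt
  have hmaps : MapsTo (fun s : ℝ => (s, x)) (Icc 0 T) (cyl T Ω) := fun y hy => ⟨hy, hx⟩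
  have h3 := (h1.comp t h2 hmaps).hasFDerivAt (Icc_mem_nhds ht.1 ht.2)
  exact h3.hasDerivAt

theorem continuousOn_slice (hF : ContinuousOn F (cyl T Ω)) {t : ℝ} (ht : t ∈ Icc 0 T) :
    ContinuousOn (fun y => F (t, y)) (closure Ω) :=
  hF.comp (by fun_prop) fun _ hy => ⟨ht, hy⟩

theorem integrableOn_slice (hb : Bornology.IsBounded Ω) (hF : ContinuousOn F (cyl T Ω))
    {t : ℝ} (ht : t ∈ Icc 0 T) : IntegrableOn (fun y => F (t, y)) Ω :=
  ((continuousOn_slice hF ht).integrableOn_compact hb.isCompact_closure).mono_set subset_closure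

theorem exists_bound_cyl (hb : Bornology.IsBounded Ω) (hF : ContinuousOn F (cyl T Ω)) :
    ∃ C, ∀ q ∈ cyl T Ω, ‖F q‖ ≤ C :=
  (isCompact_cyl hb).exists_bound_of_continuousOn hF

theorem continuousOn_integral_slice (ho : IsOpen Ω) (hb : Bornology.IsBounded Ω)
    (hF : ContinuousOn F (cyl T Ω)) :
    ContinuousOn (fun s => ∫ x in Ω, F (s, x)) (Icc 0 T) := by
  obtain ⟨C, hC⟩ := exists_bound_cyl hb hF
  have hfin : volume Ω < ⊤ := hb.measure_lt_top
  refine continuousOn_of_dominated (bound := fun _ => C)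
    (fun s hs => (integrableOn_slice hb hF hs).aestronglyMeasurable)
    (fun s hs => ?_) (integrableOn_const hfin.ne) ?_
  · filter_upwards [ae_restrict_mem ho.measurableSet] with x hx
    exact hC _ ⟨hs, subset_closure hx⟩
  · filter_upwards [ae_restrict_mem ho.measurableSet] with x hx
    exact hF.comp (by fun_prop) fun _ hy => ⟨hy, subset_closure hx⟩

theorem hasDerivAt_integral_slice (ho : IsOpen Ω) (hb : Bornology.IsBounded Ω)
    (hU : UniqueDiffOn ℝ (cyl T Ω)) (hF : ContDiffOn ℝ (⊤ : ℕ∞) F (cyl T Ω))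
    {t : ℝ} (ht : t ∈ Ioo 0 T) :
    HasDerivAt (fun s => ∫ x in Ω, F (s, x)) (∫ x in Ω, dirD T Ω dt F (t, x)) t := by
  have hD := (hF.dirD hU dt).continuousOn
  obtain ⟨C, hC⟩ := exists_bound_cyl hb hD
  have hfin : volume Ω < ⊤ := hb.measure_lt_top
  have hmem : Ioo 0 T ∈ 𝓝 t := Ioo_mem_nhds ht.1 ht.2
  refine (hasDerivAt_integral_of_dominated_loc_of_deriv_le (bound := fun _ => C)
    (F := fun s x => F (s, x)) (F' := fun s x => dirD T Ω dt F (s, x)) hmem ?_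
    (integrableOn_slice hb hF.continuousOn (Ioo_subset_Icc_self ht))
    (integrableOn_slice hb hD (Ioo_subset_Icc_self ht)).aestronglyMeasurable ?_
    (integrableOn_const hfin.ne) ?_).2
  · filter_upwards [hmem] with s hs
    exact (integrableOn_slice hb hF.continuousOn (Ioo_subset_Icc_self hs)).aestronglyMeasurable
  · filter_upwards [ae_restrict_mem ho.measurableSet] with x hx s hs
    exact hC _ ⟨Ioo_subset_Icc_self hs, subset_closure hx⟩
  · filter_upwards [ae_restrict_mem ho.measurableSet] with x hx s hs
    exact hasDerivAt_slice hF hs (subset_closure hx)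

theorem energy_le_of_integral_le (hT : 0 < T) (ho : IsOpen Ω) (hb : Bornology.IsBounded Ω)
    (hU : UniqueDiffOn ℝ (cyl T Ω)) {e d f : ℝ × E3 → ℝ}
    (he : ContDiffOn ℝ (⊤ : ℕ∞) e (cyl T Ω)) (hd : ContinuousOn d (cyl T Ω))
    (hf : ContinuousOn f (cyl T Ω))
    (hle : ∀ t ∈ Ioo 0 T,
      ∫ x in Ω, (dirD T Ω dt e (t, x) + d (t, x) - f (t, x)) ≤ 0) :
    (∫ x in Ω, e (T, x)) + (∫ s in (0 : ℝ)..T, ∫ x in Ω, d (s, x)) ≤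
      (∫ s in (0 : ℝ)..T, ∫ x in Ω, f (s, x)) + ∫ x in Ω, e (0, x) := by
  have cd := continuousOn_integral_slice ho hb hd
  have cf := continuousOn_integral_slice ho hb hf
  have key := intervalIntegral.sub_le_integral_of_hasDeriv_right_of_le hT.le
    (continuousOn_integral_slice ho hb he.continuousOn)
    (fun t ht => (hasDerivAt_integral_slice ho hb hU he ht).hasDerivWithinAt)
    (φ := fun s => (∫ x in Ω, f (s, x)) - ∫ x in Ω, d (s, x))
    ((cf.sub cd).integrableOn_compact isCompact_Icc) ?_
  · rw [intervalIntegral.integral_sub] at key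
    · linarith
    · exact cf.intervalIntegrable_of_Icc hT.le
    · exact cd.intervalIntegrable_of_Icc hT.le
  · intro t ht
    have h := hle t ht
    have ht' := Ioo_subset_Icc_self ht
    have i1 := integrableOn_slice hb (he.dirD hU dt).continuousOn ht'
    have i2 := integrableOn_slice hb hd ht'
    have i3 := integrableOn_slice hb hf ht'
    rw [integral_sub (Integrable.fun_add i1 i2) i3, integral_add i1 i2] at h
    linarith

end Slices

section IntegrationByParts

variable {Ω : Set E3}

theorem exists_mem_segment_frontier (ho : IsOpen Ω) {x y : E3} (hx : x ∈ Ω) (hy : y ∉ Ω) :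
    ∃ z ∈ segment ℝ x y, z ∈ frontier Ω := by
  by_contra! h
  have hyc : y ∉ closure Ω := fun hyc =>
    h y (right_mem_segment ℝ x y) ⟨hyc, by rwa [ho.interior_eq]⟩
  obtain ⟨z, -, hz1, hz2⟩ := (convex_segment (𝕜 := ℝ) x y).isPreconnected Ω (closure Ω)ᶜ ho
    isClosed_closure.isOpen_compl
    (fun z hz => by
      by_contra hzn
      rw [mem_union, not_or, notMem_compl_iff] at hzn
      exact h z hz ⟨hzn.2, by rw [ho.interior_eq]; exact hzn.1⟩)
    ⟨x, left_mem_segment ℝ x y, hx⟩ ⟨y, right_mem_segment ℝ x y, hyc⟩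
  exact hz2 (subset_closure hz1)

theorem lipschitzWith_indicator (ho : IsOpen Ω) {f : E3 → ℝ} {C : NNReal}
    (hf : LipschitzOnWith C f (closure Ω)) (h0 : ∀ x ∈ frontier Ω, f x = 0) :
    LipschitzWith C (Ω.indicator f) := by
  have aux : ∀ x ∈ Ω, ∀ y ∉ Ω, dist (f x) 0 ≤ C * dist x y := by
    intro x hx y hy
    obtain ⟨z, hz, hzf⟩ := exists_mem_segment_frontier ho hx hy
    have h1 := hf.dist_le_mul x (subset_closure hx) z (frontier_subset_closure hzf)
    rw [h0 z hzf] at h1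
    have h2 := dist_add_dist_of_mem_segment hz
    have h3 : dist x z ≤ dist x y := by linarith [dist_nonneg (x := z) (y := y)]
    exact h1.trans (mul_le_mul_of_nonneg_left h3 C.coe_nonneg)
  refine LipschitzWith.of_dist_le_mul fun x y => ?_
  by_cases hx : x ∈ Ω <;> by_cases hy : y ∈ Ω
  · simpa [hx, hy] using hf.dist_le_mul x (subset_closure hx) y (subset_closure hy)
  · simpa [hx, hy] using aux x hx y hy
  · rw [dist_comm, dist_comm x y]
    simpa [hx, hy] using aux y hy x hx
  · simp [hx, hy]
    positivity

theorem integral_pdS_eq_zero (ho : IsOpen Ω) (hb : Bornology.IsBounded Ω) (hc : Convex ℝ Ω)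
    {f : E3 → ℝ} (hf : ContDiffOn ℝ 1 f (closure Ω)) (h0 : ∀ x ∈ frontier Ω, f x = 0)
    (i : Fin 3) : ∫ x in Ω, pdS f i x = 0 := by
  rcases Ω.eq_empty_or_nonempty with rfl | hne
  · simp
  have hU : UniqueDiffOn ℝ (closure Ω) :=
    uniqueDiffOn_convex hc.closure (hne.mono (ho.subset_interior_iff.2 subset_closure))
  obtain ⟨C, hC⟩ := hb.isCompact_closure.exists_bound_of_continuousOn
    (hf.continuousOn_fderivWithin hU le_rfl)
  have hL : LipschitzOnWith C.toNNReal f (closure Ω) :=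
    hc.closure.lipschitzOnWith_of_nnnorm_fderivWithin_le
      (hf.differentiableOn (by simp)) fun x hx => by
        rw [← NNReal.coe_le_coe, coe_nnnorm]
        exact (hC x hx).trans (Real.le_coe_toNNReal C)
  have hg := lipschitzWith_indicator ho hL h0
  have hsupp : HasCompactSupport (Ω.indicator f) :=
    HasCompactSupport.intro hb.isCompact_closure fun x hx =>
      indicator_of_notMem (fun h => hx (subset_closure h)) f
  set v : E3 := EuclideanSpace.single i 1
  have key := LipschitzWith.integral_lineDeriv_mul_eq (μ := (volume : Measure E3))
    (LipschitzWith.const (1 : ℝ)) hg hsupp (-v)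
  have hz : ∀ x : E3, lineDeriv ℝ (fun _ : E3 => (1 : ℝ)) x (-v) = 0 := fun x => by
    simp [lineDeriv]
  simp only [hz, zero_mul, integral_zero, mul_one, neg_neg] at key
  rw [← integral_indicator ho.measurableSet, key]
  refine integral_congr_ae ?_
  have hfr : ∀ᵐ x : E3, x ∉ frontier Ω :=
    measure_eq_zero_iff_ae_notMem.1 (hc.addHaar_frontier volume)
  filter_upwards [hfr] with x hx
  by_cases hxΩ : x ∈ Ω
  · have he : Ω.indicator f =ᶠ[𝓝 x] f :=
      eventually_of_mem (ho.mem_nhds hxΩ) fun y hy => indicator_of_mem hy f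
    have hd : DifferentiableAt ℝ f x :=
      ((hf.contDiffAt (mem_of_superset (ho.mem_nhds hxΩ) subset_closure)).differentiableAt
        (by simp))
    rw [indicator_of_mem hxΩ, he.lineDeriv_eq, hd.lineDeriv_eq_fderiv]
    rfl
  · have hxc : x ∉ closure Ω := fun h => hx ⟨h, by rwa [ho.interior_eq]⟩
    have he : Ω.indicator f =ᶠ[𝓝 x] fun _ => 0 :=
      eventually_of_mem (isClosed_closure.isOpen_compl.mem_nhds hxc)
        fun y hy => indicator_of_notMem (fun h => hy (subset_closure h)) f
    rw [indicator_of_notMem hxΩ, he.lineDeriv_eq]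
    simp [lineDeriv]

variable {T : ℝ} {F G : ℝ × E3 → ℝ}

theorem integral_dirD_mul_add (ho : IsOpen Ω) (hb : Bornology.IsBounded Ω) (hc : Convex ℝ Ω)
    (hU : UniqueDiffOn ℝ (cyl T Ω))
    (hF : ContDiffOn ℝ (⊤ : ℕ∞) F (cyl T Ω)) (hG : ContDiffOn ℝ (⊤ : ℕ∞) G (cyl T Ω))
    {t : ℝ} (ht : t ∈ Icc 0 T) (h0 : ∀ x ∈ frontier Ω, F (t, x) = 0) (i : Fin 3) :
    ∫ x in Ω, (dirD T Ω (dx i) F (t, x) * G (t, x) + F (t, x) * dirD T Ω (dx i) G (t, x)) = 0 := by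
  have hFG := hF.mul hG
  rw [← integral_pdS_eq_zero ho hb hc (f := fun x => F (t, x) * G (t, x)) ?_ ?_ i]
  · refine setIntegral_congr_fun ho.measurableSet fun x hx => ?_
    exact (dirD_mul hU (dx i) hF hG ⟨ht, subset_closure hx⟩).symm.trans
      (pdS_slice ho hFG ht hx i).symm
  · exact (hFG.of_le (by norm_cast)).comp (by fun_prop) fun y hy => ⟨ht, hy⟩
  · intro x hx
    simp [h0 x hx]

/-- A field orthogonal in `L²(Ω)` to the gradients of all smooth functions on the whole space is
orthogonal to the gradients of functions that are smooth up to the boundary. -/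
theorem integral_mul_pdS_eq_zero (ho : IsOpen Ω) (hb : Bornology.IsBounded Ω) (hc : Convex ℝ Ω)
    {V : Fin 3 → E3 → ℝ} (hV : ∀ j, ContinuousOn (V j) (closure Ω))
    (horth : ∀ χ : E3 → ℝ, ContDiff ℝ (⊤ : ℕ∞) χ → ∫ x in Ω, ∑ j, V j x * pdS χ j x = 0)
    {ψ : E3 → ℝ} (hψ : ContDiffOn ℝ (⊤ : ℕ∞) ψ (closure Ω)) :
    ∫ x in Ω, ∑ j, V j x * pdS ψ j x = 0 := by
  rcases Ω.eq_empty_or_nonempty with rfl | ⟨x₀, hx₀⟩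
  · simp
  have hU : UniqueDiffOn ℝ (closure Ω) :=
    uniqueDiffOn_convex hc.closure ⟨x₀, ho.subset_interior_iff.2 subset_closure hx₀⟩
  let r : ℕ → ℝ := fun n => 1 / ((n : ℝ) + 2)
  have hr0 : ∀ n, 0 < r n := fun n => by positivity
  have hr1 : ∀ n, r n ≤ 1 := fun n => by
    simp only [r]
    rw [div_le_one (by positivity)]
    linarith [Nat.cast_nonneg (α := ℝ) n]
  have hr : Tendsto r atTop (𝓝 0) := by
    have h := (tendsto_const_div_atTop_nhds_zero_nat (1 : ℝ)).comp (tendsto_add_atTop_nat 2)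
    refine h.congr fun n => ?_
    simp [r]
  let A : ℕ → E3 → E3 := fun n y => y + r n • (x₀ - y)
  have hA : ∀ n, ∀ y ∈ closure Ω, A n y ∈ Ω := fun n y hy => by
    have := hc.add_smul_sub_mem_interior' hy (ho.interior_eq.symm ▸ hx₀) ⟨hr0 n, hr1 n⟩
    rwa [ho.interior_eq] at this
  have hAsm : ∀ n, ContDiff ℝ (⊤ : ℕ∞) (A n) := fun n => by
    simp only [A]
    fun_prop
  have hAd : ∀ n x, HasFDerivAt (A n) ((1 - r n) • ContinuousLinearMap.id ℝ E3) x := by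
    intro n x
    have h := (hasFDerivAt_id (𝕜 := ℝ) x).add
      (((hasFDerivAt_const x₀ x).sub (hasFDerivAt_id (𝕜 := ℝ) x)).const_smul (r n))
    refine h.congr_fderiv ?_
    ext y
    simp [sub_smul]
    ring
  have hψd : ∀ x ∈ Ω, HasFDerivAt ψ (fderiv ℝ ψ x) x := fun x hx =>
    ((hψ.contDiffAt (mem_of_superset (ho.mem_nhds hx) subset_closure)).differentiableAt
      (by simp)).hasFDerivAt
  have hzero : ∀ n, ∫ x in Ω, ∑ j, V j x * ((1 - r n) * pdS ψ j (A n x)) = 0 := by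
    intro n
    obtain ⟨η, hη0, hη1, -⟩ := exists_contMDiffMap_zero_one_nhds_of_isClosed (n := (⊤ : ℕ∞))
      (modelWithCornersSelf ℝ E3) (s := (A n ⁻¹' Ω)ᶜ) (t := closure Ω)
      (ho.preimage (hAsm n).continuous).isClosed_compl isClosed_closure
      (disjoint_compl_left_iff_subset.2 (hA n))
    rw [← horth (fun y => η y * ψ (A n y)) ?_]
    · refine setIntegral_congr_fun ho.measurableSet fun x hx => ?_
      refine Finset.sum_congr rfl fun j _ => ?_
      have he : (fun y => η y * ψ (A n y)) =ᶠ[𝓝 x] fun y => ψ (A n y) := by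
        filter_upwards [hη1.filter_mono (nhds_le_nhdsSet (subset_closure hx))] with y hy
        rw [hy, one_mul]
      have hd := (hψd _ (hA n x (subset_closure hx))).comp x (hAd n x)
      simp only [pdS]
      rw [he.fderiv_eq]
      erw [hd.fderiv]
      simp
    · rw [contDiff_iff_contDiffAt]
      intro y
      by_cases hy : A n y ∈ Ω
      · exact η.contMDiff.contDiff.contDiffAt.mul
          ((hψ.contDiffAt (mem_of_superset (ho.mem_nhds hy) subset_closure)).comp y
            (hAsm n).contDiffAt)
      · refine (contDiffAt_const (c := (0 : ℝ))).congr_of_eventuallyEq ?_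
        filter_upwards [hη0.filter_mono (nhds_le_nhdsSet hy)] with z hz
        rw [hz, zero_mul]
  have hcont : ∀ j, ContinuousOn (fun x => fderivWithin ℝ ψ (closure Ω) x
      (EuclideanSpace.single j 1)) (closure Ω) := fun j =>
    (hψ.continuousOn_fderivWithin hU (by simp)).clm_apply continuousOn_const
  have hpd : ∀ j, ∀ x ∈ Ω, fderivWithin ℝ ψ (closure Ω) x (EuclideanSpace.single j 1) =
      pdS ψ j x := fun j x hx => by
    rw [fderivWithin_of_mem_nhds (mem_of_superset (ho.mem_nhds hx) subset_closure)]
    rfl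
  have hpdc : ∀ j, ContinuousOn (pdS ψ j) Ω := fun j =>
    ((hcont j).mono subset_closure).congr fun x hx => (hpd j x hx).symm
  choose C hC using fun j => hb.isCompact_closure.exists_bound_of_continuousOn (hcont j)
  choose B hB using fun j => hb.isCompact_closure.exists_bound_of_continuousOn (hV j)
  have hfin : volume Ω < ⊤ := hb.measure_lt_top
  have hlim : Tendsto (fun n => ∫ x in Ω, ∑ j, V j x * ((1 - r n) * pdS ψ j (A n x))) atTop
      (𝓝 (∫ x in Ω, ∑ j, V j x * pdS ψ j x)) := by
    refine tendsto_integral_of_dominated_convergence (fun _ => ∑ j, B j * C j) (fun n => ?_)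
      (integrableOn_const hfin.ne) (fun n => ?_) ?_
    · refine ContinuousOn.aestronglyMeasurable ?_ ho.measurableSet
      refine continuousOn_finsetSum _ fun j _ => ?_
      refine ((hV j).mono subset_closure).mul (continuousOn_const.mul ?_)
      exact (hpdc j).comp (hAsm n).continuous.continuousOn fun x hx => hA n x (subset_closure hx)
    · filter_upwards [ae_restrict_mem ho.measurableSet] with x hx
      refine (norm_sum_le _ _).trans (Finset.sum_le_sum fun j _ => ?_)
      have h1 := hB j x (subset_closure hx)
      have hAx := hA n x (subset_closure hx)
      have h2 := hC j (A n x) (subset_closure hAx)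
      rw [hpd j _ hAx] at h2
      rw [norm_mul, norm_mul]
      have h3 : ‖1 - r n‖ ≤ 1 := by
        rw [Real.norm_eq_abs, abs_le]
        constructor <;> linarith [hr0 n, hr1 n]
      refine mul_le_mul h1 ?_ (by positivity) ((norm_nonneg _).trans h1)
      calc ‖1 - r n‖ * ‖pdS ψ j (A n x)‖ ≤ 1 * ‖pdS ψ j (A n x)‖ := by gcongr
        _ ≤ C j := by rwa [one_mul]
    · filter_upwards [ae_restrict_mem ho.measurableSet] with x hx
      refine tendsto_finsetSum _ fun j _ => Tendsto.const_mul _ ?_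
      have hAx : Tendsto (fun n => A n x) atTop (𝓝 x) := by
        have h := (tendsto_const_nhds (x := x)).add (hr.smul_const (x₀ - x))
        simpa [A] using h
      have h1 : Tendsto (fun n => pdS ψ j (A n x)) atTop (𝓝 (pdS ψ j x)) :=
        ((hpdc j).continuousAt (ho.mem_nhds hx)).tendsto.comp hAx
      simpa using (hr.const_sub 1).mul h1
  refine tendsto_nhds_unique hlim ?_
  simp only [hzero]
  exact tendsto_const_nhds

end IntegrationByParts

/-- The pointwise form of the energy inequality: up to expressions that integrate to zero, the
energy density balance follows from the equations and Young's inequality. -/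
theorem energy_density_le {ν νr c₁ c₂ jmom μ₀ κ₀ 𝒯 : ℝ} (hμ₀ : 0 ≤ μ₀) (hκ₀ : 0 ≤ κ₀) (h𝒯 : 0 < 𝒯)
    {u w m h a ut wt mt ht a_t dp : Fin 3 → ℝ} {du dw dm dh : Fin 3 → Fin 3 → ℝ}
    {d2u d2w : Fin 3 → Fin 3 → Fin 3 → ℝ}
    (hdiv : ∑ i, du i i = 0) (hsym : ∀ i j, dh i j = dh j i)
    (hcomm : ∀ i j k, d2u i j k = d2u j i k)
    (hlin : ∀ j, ut j + (∑ i, u i * du i j) - (ν + νr) * (∑ i, d2u i i j) + dp j =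
      2 * νr * (dw (j + 1) (j + 2) - dw (j + 2) (j + 1)) + μ₀ * ∑ i, m i * dh i j)
    (hang : ∀ j, jmom * wt j + jmom * (∑ i, u i * dw i j) - c₁ * (∑ i, d2w i i j) -
        c₂ * (∑ i, d2w j i i) + 4 * νr * w j =
      2 * νr * (du (j + 1) (j + 2) - du (j + 2) (j + 1)) +
        μ₀ * (m (j + 1) * h (j + 2) - m (j + 2) * h (j + 1)))
    (hmag : ∀ j, mt j + (∑ i, u i * dm i j) =
      (w (j + 1) * m (j + 2) - w (j + 2) * m (j + 1)) - (1 / 𝒯) * (m j - κ₀ * h j)) :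
    ((∑ j, ut j * u j) + jmom * (∑ j, wt j * w j) + μ₀ * (∑ j, mt j * m j) +
          μ₀ * (∑ j, ht j * h j)) +
        (ν * (∑ i, ∑ j, du i j ^ 2) + c₁ * (∑ i, ∑ j, dw i j ^ 2) + c₂ * (∑ i, dw i i) ^ 2 +
          νr * (∑ j, (du (j + 1) (j + 2) - du (j + 2) (j + 1) - 2 * w j) ^ 2) +
          (μ₀ / 𝒯) * (∑ j, m j * m j) +
          (μ₀ / (2 * 𝒯)) * (1 / 2 + 3 * κ₀) * (∑ j, h j * h j)) -
        (𝒯 * μ₀ * (∑ j, a_t j ^ 2) + (μ₀ / (2 * 𝒯)) * (1 + κ₀) * (∑ j, a j * a j)) ≤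
      (-1) * (∑ i, u i * dp i) +
      (-(1 / 2)) * (∑ i, u i * ∑ j, (du i j * u j + u j * du i j)) +
      (-(jmom / 2)) * (∑ i, u i * ∑ j, (dw i j * w j + w j * dw i j)) +
      (-(μ₀ / 2)) * (∑ i, u i * ∑ j, (dm i j * m j + m j * dm i j)) +
      μ₀ * (∑ i, u i * ∑ j, (dm i j * h j + m j * dh i j)) +
      (ν + νr) * (∑ i, ∑ j, (du i j * du i j + u j * d2u i i j)) +
      c₁ * (∑ i, ∑ j, (dw i j * dw i j + w j * d2w i i j)) +
      c₂ * (∑ i, ∑ j, (dw j j * dw i i + w j * d2w j i i)) +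
      (2 * νr) * (∑ k, (du (k + 1) k * w (k + 2) + u k * dw (k + 1) (k + 2))) +
      (-(2 * νr)) * (∑ k, (du (k + 2) k * w (k + 1) + u k * dw (k + 2) (k + 1))) +
      (-νr) * (∑ i, ∑ j, (du i j * du j i + u j * d2u i j i)) +
      νr * (∑ i, ∑ j, (du j j * du i i + u j * d2u j i i)) +
      (μ₀ * (1 + κ₀) / 𝒯) * (∑ j, (h j - a j + m j) * h j) +
      μ₀ * (∑ j, (ht j - a_t j + mt j) * h j) := by
  have hY : 0 ≤ μ₀ * 𝒯 * (∑ j, (a_t j - h j / (2 * 𝒯)) ^ 2) +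
      μ₀ * (1 + κ₀) / (2 * 𝒯) * (∑ j, (a j - h j) ^ 2) := by positivity
  obtain ⟨τ, hτ⟩ : ∃ τ, τ = 1 / 𝒯 := ⟨_, rfl⟩
  have hτ1 : 𝒯 * τ = 1 := by rw [hτ]; field_simp
  have e1 : μ₀ / 𝒯 = μ₀ * τ := by rw [hτ]; ring
  have e2 : μ₀ / (2 * 𝒯) = μ₀ * τ / 2 := by rw [hτ]; ring
  have e3 : μ₀ * (1 + κ₀) / 𝒯 = μ₀ * (1 + κ₀) * τ := by rw [hτ]; ring
  have e4 : μ₀ * (1 + κ₀) / (2 * 𝒯) = μ₀ * (1 + κ₀) * τ / 2 := by rw [hτ]; ring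
  have e5 : ∀ j, h j / (2 * 𝒯) = h j * τ / 2 := fun j => by rw [hτ]; ring
  simp only [e4, e5] at hY
  rw [e1, e2, e3]
  simp only [← hτ] at hmag
  have s10 := hsym 1 0
  have s20 := hsym 2 0
  have s21 := hsym 2 1
  have i11 : (1 + 1 : Fin 3) = 2 := rfl
  have i12 : (1 + 2 : Fin 3) = 0 := rfl
  have i21 : (2 + 1 : Fin 3) = 0 := rfl
  have i22 : (2 + 2 : Fin 3) = 1 := rfl
  have l0 := hlin 0
  have l1 := hlin 1
  have l2 := hlin 2
  have a0 := hang 0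
  have a1 := hang 1
  have a2 := hang 2
  have m0 := hmag 0
  have m1 := hmag 1
  have m2 := hmag 2
  have d10 := fun k => hcomm 1 0 k
  have d20 := fun k => hcomm 2 0 k
  have d21 := fun k => hcomm 2 1 k
  simp only [Fin.sum_univ_three, zero_add, i11, i12, i21, i22] at *
  rw [← sub_nonneg]
  refine hY.trans_eq ?_
  linear_combination u 0 * l0 + u 1 * l1 + u 2 * l2 + w 0 * a0 + w 1 * a1 + w 2 * a2 +
    μ₀ * (m 0 - h 0) * m0 + μ₀ * (m 1 - h 1) * m1 + μ₀ * (m 2 - h 2) * m2 +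
    (-μ₀ * (a_t 0 * h 0 + a_t 1 * h 1 + a_t 2 * h 2) +
      μ₀ * τ / 4 * (h 0 ^ 2 + h 1 ^ 2 + h 2 ^ 2)) * hτ1 -
    νr * (du 0 0 + du 1 1 + du 2 2) * hdiv +
    νr * (u 0 * d10 1 - u 1 * d10 0 + u 0 * d20 2 - u 2 * d20 0 + u 1 * d21 2 - u 2 * d21 1) +
    μ₀ * ((u 0 * m 1 - u 1 * m 0) * s10 + (u 0 * m 2 - u 2 * m 0) * s20 +
      (u 1 * m 2 - u 2 * m 1) * s21)

/-- Integrable functions on `Ω` with vanishing integral. -/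
def ZeroMean (Ω : Set E3) (g : E3 → ℝ) : Prop := IntegrableOn g Ω ∧ ∫ x in Ω, g x = 0

theorem ZeroMean.add {Ω : Set E3} {f g : E3 → ℝ} (hf : ZeroMean Ω f) (hg : ZeroMean Ω g) :
    ZeroMean Ω fun x => f x + g x :=
  ⟨hf.1.add hg.1, by rw [integral_add hf.1 hg.1, hf.2, hg.2, add_zero]⟩

theorem ZeroMean.const_mul {Ω : Set E3} {f : E3 → ℝ} (hf : ZeroMean Ω f) (c : ℝ) :
    ZeroMean Ω fun x => c * f x :=
  ⟨Integrable.const_mul hf.1 c, by rw [integral_const_mul, hf.2, mul_zero]⟩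

theorem ZeroMean.congr {Ω : Set E3} (ho : IsOpen Ω) {f g : E3 → ℝ} (hf : ZeroMean Ω f)
    (h : ∀ x ∈ Ω, f x = g x) : ZeroMean Ω g :=
  ⟨hf.1.congr_fun h ho.measurableSet, by
    rw [← setIntegral_congr_fun ho.measurableSet h, hf.2]⟩

section ZeroMeanIdentities

variable {T : ℝ} {Ω : Set E3} {t : ℝ}

theorem zeroMean_sum_dirD_mul_add (ho : IsOpen Ω) (hb : Bornology.IsBounded Ω)
    (hc : Convex ℝ Ω) (hU : UniqueDiffOn ℝ (cyl T Ω)) {ι : Type*} [Fintype ι]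
    (k : ι → Fin 3) {F G : ι → ℝ × E3 → ℝ}
    (hF : ∀ a, ContDiffOn ℝ (⊤ : ℕ∞) (F a) (cyl T Ω))
    (hG : ∀ a, ContDiffOn ℝ (⊤ : ℕ∞) (G a) (cyl T Ω)) (ht : t ∈ Icc 0 T)
    (h0 : ∀ a, ∀ x ∈ frontier Ω, F a (t, x) = 0) :
    ZeroMean Ω fun x => ∑ a, (dirD T Ω (dx (k a)) (F a) (t, x) * G a (t, x) +
      F a (t, x) * dirD T Ω (dx (k a)) (G a) (t, x)) := by
  have hi : ∀ a, IntegrableOn (fun x => dirD T Ω (dx (k a)) (F a) (t, x) * G a (t, x) +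
      F a (t, x) * dirD T Ω (dx (k a)) (G a) (t, x)) Ω := fun a =>
    integrableOn_slice (F := fun q => dirD T Ω (dx (k a)) (F a) q * G a q +
      F a q * dirD T Ω (dx (k a)) (G a) q) hb
      ((((hF a).dirD hU _).mul (hG a)).add ((hF a).mul ((hG a).dirD hU _))).continuousOn ht
  refine ⟨integrable_finsetSum _ fun a _ => hi a, ?_⟩
  rw [integral_finsetSum _ fun a _ => hi a]
  exact Finset.sum_eq_zero fun a _ =>
    integral_dirD_mul_add ho hb hc hU (hF a) (hG a) ht (h0 a) (k a)

theorem zeroMean_convective (ho : IsOpen Ω) (hb : Bornology.IsBounded Ω)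
    (hc : Convex ℝ Ω) (hU : UniqueDiffOn ℝ (cyl T Ω)) {U : Fin 3 → ℝ × E3 → ℝ}
    {F : ℝ × E3 → ℝ} (hUs : ∀ j, ContDiffOn ℝ (⊤ : ℕ∞) (U j) (cyl T Ω))
    (hF : ContDiffOn ℝ (⊤ : ℕ∞) F (cyl T Ω)) (ht : t ∈ Icc 0 T)
    (h0 : ∀ j, ∀ x ∈ frontier Ω, U j (t, x) = 0)
    (hdiv : ∀ x ∈ Ω, ∑ i, dirD T Ω (dx i) (U i) (t, x) = 0) :
    ZeroMean Ω fun x => ∑ i, U i (t, x) * dirD T Ω (dx i) F (t, x) := by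
  refine (zeroMean_sum_dirD_mul_add ho hb hc hU id hUs (fun _ => hF) ht h0).congr ho
    fun x hx => ?_
  rw [Finset.sum_add_distrib, ← Finset.sum_mul]
  simp [hdiv x hx]

theorem dirD_sum_mul (hU : UniqueDiffOn ℝ (cyl T Ω)) (v : ℝ × E3) {F G : Fin 3 → ℝ × E3 → ℝ}
    (hF : ∀ j, ContDiffOn ℝ (⊤ : ℕ∞) (F j) (cyl T Ω))
    (hG : ∀ j, ContDiffOn ℝ (⊤ : ℕ∞) (G j) (cyl T Ω)) {q : ℝ × E3} (hq : q ∈ cyl T Ω) :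
    dirD T Ω v (fun q => ∑ j, F j q * G j q) q =
      ∑ j, (dirD T Ω v (F j) q * G j q + F j q * dirD T Ω v (G j) q) :=
  (dirD_sum hU v (fun j => (hF j).mul (hG j)) hq).trans
    (Finset.sum_congr rfl fun j _ => dirD_mul hU v (hF j) (hG j) hq)

theorem zeroMean_convective_sum_mul (ho : IsOpen Ω) (hb : Bornology.IsBounded Ω)
    (hc : Convex ℝ Ω) (hU : UniqueDiffOn ℝ (cyl T Ω)) {U F G : Fin 3 → ℝ × E3 → ℝ}
    (hUs : ∀ j, ContDiffOn ℝ (⊤ : ℕ∞) (U j) (cyl T Ω))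
    (hF : ∀ j, ContDiffOn ℝ (⊤ : ℕ∞) (F j) (cyl T Ω))
    (hG : ∀ j, ContDiffOn ℝ (⊤ : ℕ∞) (G j) (cyl T Ω)) (ht : t ∈ Icc 0 T)
    (h0 : ∀ j, ∀ x ∈ frontier Ω, U j (t, x) = 0)
    (hdiv : ∀ x ∈ Ω, ∑ i, dirD T Ω (dx i) (U i) (t, x) = 0) :
    ZeroMean Ω fun x => ∑ i, U i (t, x) * ∑ j, (dirD T Ω (dx i) (F j) (t, x) * G j (t, x) +
      F j (t, x) * dirD T Ω (dx i) (G j) (t, x)) := by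
  refine (zeroMean_convective ho hb hc hU hUs (F := fun q => ∑ j, F j q * G j q)
    (ContDiffOn.sum fun j _ => (hF j).mul (hG j)) ht h0 hdiv).congr ho fun x hx => ?_
  refine Finset.sum_congr rfl fun i _ => ?_
  rw [dirD_sum_mul hU (dx i) hF hG ⟨ht, subset_closure hx⟩]

theorem zeroMean_sum_dt_mul (ho : IsOpen Ω) (hb : Bornology.IsBounded Ω)
    (hU : UniqueDiffOn ℝ (cyl T Ω)) {V H : Fin 3 → ℝ × E3 → ℝ}
    (hV : ∀ j, ContDiffOn ℝ (⊤ : ℕ∞) (V j) (cyl T Ω))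
    (hH : ∀ j, ContDiffOn ℝ (⊤ : ℕ∞) (H j) (cyl T Ω)) (ht : t ∈ Ioo 0 T)
    (horth : ∀ s ∈ Icc 0 T, ∫ x in Ω, ∑ j, V j (s, x) * H j (t, x) = 0) :
    ZeroMean Ω fun x => ∑ j, dirD T Ω dt (V j) (t, x) * H j (t, x) := by
  have ht' := Ioo_subset_Icc_self ht
  have hHt : ∀ j, ContDiffOn ℝ (⊤ : ℕ∞) (fun q : ℝ × E3 => H j (t, q.2)) (cyl T Ω) := fun j =>
    (hH j).comp (by fun_prop) fun q hq => ⟨ht', hq.2⟩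
  have hR : ContDiffOn ℝ (⊤ : ℕ∞) (fun q : ℝ × E3 => ∑ j, V j q * H j (t, q.2)) (cyl T Ω) :=
    ContDiffOn.sum fun j _ => (hV j).mul (hHt j)
  have hd := hasDerivAt_integral_slice ho hb hU hR ht
  have hz : HasDerivAt (fun s => ∫ x in Ω, ∑ j, V j (s, x) * H j (t, x)) 0 t :=
    (hasDerivAt_const t (0 : ℝ)).congr_of_eventuallyEq
      (eventually_of_mem (Icc_mem_nhds ht.1 ht.2) horth)
  have hzm : ZeroMean Ω fun x => dirD T Ω dt (fun q => ∑ j, V j q * H j (t, q.2)) (t, x) :=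
    ⟨integrableOn_slice hb (hR.dirD hU dt).continuousOn ht', hd.unique hz⟩
  refine hzm.congr ho fun x hx => ?_
  have hx' := subset_closure hx
  exact (hasDerivAt_slice hR ht hx').unique
    (HasDerivAt.fun_sum fun j _ => (hasDerivAt_slice (hV j) ht hx').mul_const (H j (t, x)))

theorem dirD_energy (hU : UniqueDiffOn ℝ (cyl T Ω)) (v : ℝ × E3) {A B C D : ℝ × E3 → ℝ}
    (hA : ContDiffOn ℝ (⊤ : ℕ∞) A (cyl T Ω)) (hB : ContDiffOn ℝ (⊤ : ℕ∞) B (cyl T Ω))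
    (hC : ContDiffOn ℝ (⊤ : ℕ∞) C (cyl T Ω)) (hD : ContDiffOn ℝ (⊤ : ℕ∞) D (cyl T Ω))
    (a b : ℝ) {q : ℝ × E3} (hq : q ∈ cyl T Ω) :
    dirD T Ω v (fun q => (1 / 2) * (A q + a * B q + b * C q + b * D q)) q =
      (1 / 2) * (dirD T Ω v A q + a * dirD T Ω v B q + b * dirD T Ω v C q +
        b * dirD T Ω v D q) := by
  have h := (((((hA.hasFDerivWithinAt_cyl hq).fun_add
    ((hB.hasFDerivWithinAt_cyl hq).const_mul a)).fun_add
    ((hC.hasFDerivWithinAt_cyl hq).const_mul b)).fun_add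
    ((hD.hasFDerivWithinAt_cyl hq).const_mul b)).const_mul (1 / 2)).fderivWithin (hU q hq)
  simp only [dirD]
  rw [h]
  simp
  ring

theorem dirD_sub_add (hU : UniqueDiffOn ℝ (cyl T Ω)) (v : ℝ × E3) {A B C : ℝ × E3 → ℝ}
    (hA : ContDiffOn ℝ (⊤ : ℕ∞) A (cyl T Ω)) (hB : ContDiffOn ℝ (⊤ : ℕ∞) B (cyl T Ω))
    (hC : ContDiffOn ℝ (⊤ : ℕ∞) C (cyl T Ω)) {q : ℝ × E3} (hq : q ∈ cyl T Ω) :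
    dirD T Ω v (fun q => A q - B q + C q) q =
      dirD T Ω v A q - dirD T Ω v B q + dirD T Ω v C q := by
  have h := (((hA.hasFDerivWithinAt_cyl hq).fun_sub (hB.hasFDerivWithinAt_cyl hq)).fun_add
    (hC.hasFDerivWithinAt_cyl hq)).fderivWithin (hU q hq)
  simp only [dirD]
  rw [h]
  simp

end ZeroMeanIdentities

section EnergyEstimate

/-- The density of the energy. -/
def energyDensity (jmom μ₀ : ℝ) (U W M H : Fin 3 → ℝ × E3 → ℝ) (q : ℝ × E3) : ℝ :=
  (1 / 2) * ((∑ j, U j q * U j q) + jmom * (∑ j, W j q * W j q) + μ₀ * (∑ j, M j q * M j q) +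
    μ₀ * (∑ j, H j q * H j q))

/-- The density of the dissipation. -/
def dissipationDensity (T : ℝ) (Ω : Set E3) (ν νr c₁ c₂ μ₀ κ₀ 𝒯 : ℝ)
    (U W M H : Fin 3 → ℝ × E3 → ℝ) (q : ℝ × E3) : ℝ :=
  ν * (∑ i, ∑ j, dirD T Ω (dx i) (U j) q ^ 2) + c₁ * (∑ i, ∑ j, dirD T Ω (dx i) (W j) q ^ 2) +
    c₂ * (∑ i, dirD T Ω (dx i) (W i) q) ^ 2 +
    νr * (∑ j, (dirD T Ω (dx (j + 1)) (U (j + 2)) q - dirD T Ω (dx (j + 2)) (U (j + 1)) q -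
      2 * W j q) ^ 2) +
    (μ₀ / 𝒯) * (∑ j, M j q * M j q) +
    (μ₀ / (2 * 𝒯)) * (1 / 2 + 3 * κ₀) * (∑ j, H j q * H j q)

/-- The density of the forcing. -/
def forcingDensity (T : ℝ) (Ω : Set E3) (μ₀ κ₀ 𝒯 : ℝ) (A : Fin 3 → ℝ × E3 → ℝ)
    (q : ℝ × E3) : ℝ :=
  𝒯 * μ₀ * (∑ j, dirD T Ω dt (A j) q ^ 2) + (μ₀ / (2 * 𝒯)) * (1 + κ₀) * (∑ j, A j q * A j q)

variable {T : ℝ} {Ω : Set E3} {ν νr c₁ c₂ jmom μ₀ κ₀ 𝒯 : ℝ}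
  {U W M H A : Fin 3 → ℝ × E3 → ℝ} {P : ℝ × E3 → ℝ}

theorem contDiffOn_energyDensity
    (hUs : ∀ j, ContDiffOn ℝ (⊤ : ℕ∞) (U j) (cyl T Ω))
    (hWs : ∀ j, ContDiffOn ℝ (⊤ : ℕ∞) (W j) (cyl T Ω))
    (hMs : ∀ j, ContDiffOn ℝ (⊤ : ℕ∞) (M j) (cyl T Ω))
    (hHs : ∀ j, ContDiffOn ℝ (⊤ : ℕ∞) (H j) (cyl T Ω)) :
    ContDiffOn ℝ (⊤ : ℕ∞) (energyDensity jmom μ₀ U W M H) (cyl T Ω) := by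
  unfold energyDensity
  fun_prop

theorem continuousOn_dissipationDensity (hU : UniqueDiffOn ℝ (cyl T Ω))
    (hUs : ∀ j, ContDiffOn ℝ (⊤ : ℕ∞) (U j) (cyl T Ω))
    (hWs : ∀ j, ContDiffOn ℝ (⊤ : ℕ∞) (W j) (cyl T Ω))
    (hMs : ∀ j, ContDiffOn ℝ (⊤ : ℕ∞) (M j) (cyl T Ω))
    (hHs : ∀ j, ContDiffOn ℝ (⊤ : ℕ∞) (H j) (cyl T Ω)) :
    ContinuousOn (dissipationDensity T Ω ν νr c₁ c₂ μ₀ κ₀ 𝒯 U W M H) (cyl T Ω) := by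
  have hdU : ∀ i j, ContinuousOn (dirD T Ω (dx i) (U j)) (cyl T Ω) := fun i j =>
    ((hUs j).dirD hU _).continuousOn
  have hdW : ∀ i j, ContinuousOn (dirD T Ω (dx i) (W j)) (cyl T Ω) := fun i j =>
    ((hWs j).dirD hU _).continuousOn
  have hW := fun j => (hWs j).continuousOn
  have hM := fun j => (hMs j).continuousOn
  have hH := fun j => (hHs j).continuousOn
  unfold dissipationDensity
  fun_prop

theorem continuousOn_forcingDensity (hU : UniqueDiffOn ℝ (cyl T Ω))
    (hAs : ∀ j, ContDiffOn ℝ (⊤ : ℕ∞) (A j) (cyl T Ω)) :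
    ContinuousOn (forcingDensity T Ω μ₀ κ₀ 𝒯 A) (cyl T Ω) := by
  have hdA : ∀ j, ContinuousOn (dirD T Ω dt (A j)) (cyl T Ω) := fun j =>
    ((hAs j).dirD hU _).continuousOn
  have hA := fun j => (hAs j).continuousOn
  unfold forcingDensity
  fun_prop

/-- The energy estimate for smooth fields on the closed space-time cylinder. -/
theorem energy_estimate_cyl (hT : 0 < T) (ho : IsOpen Ω) (hb : Bornology.IsBounded Ω)
    (hc : Convex ℝ Ω) (hμ₀ : 0 ≤ μ₀) (hκ₀ : 0 ≤ κ₀) (h𝒯 : 0 < 𝒯)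
    (hUs : ∀ j, ContDiffOn ℝ (⊤ : ℕ∞) (U j) (cyl T Ω))
    (hWs : ∀ j, ContDiffOn ℝ (⊤ : ℕ∞) (W j) (cyl T Ω))
    (hMs : ∀ j, ContDiffOn ℝ (⊤ : ℕ∞) (M j) (cyl T Ω))
    (hHs : ∀ j, ContDiffOn ℝ (⊤ : ℕ∞) (H j) (cyl T Ω))
    (hAs : ∀ j, ContDiffOn ℝ (⊤ : ℕ∞) (A j) (cyl T Ω))
    (hPs : ContDiffOn ℝ (⊤ : ℕ∞) P (cyl T Ω))
    (hU0 : ∀ t ∈ Icc 0 T, ∀ j, ∀ x ∈ frontier Ω, U j (t, x) = 0)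
    (hW0 : ∀ t ∈ Icc 0 T, ∀ j, ∀ x ∈ frontier Ω, W j (t, x) = 0)
    (hdiv : ∀ t ∈ Icc 0 T, ∀ x ∈ Ω, ∑ i, dirD T Ω (dx i) (U i) (t, x) = 0)
    (hsym : ∀ t ∈ Ioo 0 T, ∀ x ∈ Ω, ∀ i j,
      dirD T Ω (dx i) (H j) (t, x) = dirD T Ω (dx j) (H i) (t, x))
    (horth : ∀ s ∈ Icc 0 T, ∀ t ∈ Icc 0 T,
      ∫ x in Ω, ∑ j, (H j (s, x) - A j (s, x) + M j (s, x)) * H j (t, x) = 0)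
    (hlin : ∀ t ∈ Ioo 0 T, ∀ x ∈ Ω, ∀ j,
      dirD T Ω dt (U j) (t, x) + (∑ i, U i (t, x) * dirD T Ω (dx i) (U j) (t, x)) -
          (ν + νr) * (∑ i, dirD T Ω (dx i) (dirD T Ω (dx i) (U j)) (t, x)) +
          dirD T Ω (dx j) P (t, x) =
        2 * νr * (dirD T Ω (dx (j + 1)) (W (j + 2)) (t, x) -
          dirD T Ω (dx (j + 2)) (W (j + 1)) (t, x)) +
          μ₀ * ∑ i, M i (t, x) * dirD T Ω (dx i) (H j) (t, x))
    (hang : ∀ t ∈ Ioo 0 T, ∀ x ∈ Ω, ∀ j,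
      jmom * dirD T Ω dt (W j) (t, x) +
          jmom * (∑ i, U i (t, x) * dirD T Ω (dx i) (W j) (t, x)) -
          c₁ * (∑ i, dirD T Ω (dx i) (dirD T Ω (dx i) (W j)) (t, x)) -
          c₂ * (∑ i, dirD T Ω (dx j) (dirD T Ω (dx i) (W i)) (t, x)) + 4 * νr * W j (t, x) =
        2 * νr * (dirD T Ω (dx (j + 1)) (U (j + 2)) (t, x) -
          dirD T Ω (dx (j + 2)) (U (j + 1)) (t, x)) +
          μ₀ * (M (j + 1) (t, x) * H (j + 2) (t, x) - M (j + 2) (t, x) * H (j + 1) (t, x)))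
    (hmag : ∀ t ∈ Ioo 0 T, ∀ x ∈ Ω, ∀ j,
      dirD T Ω dt (M j) (t, x) + (∑ i, U i (t, x) * dirD T Ω (dx i) (M j) (t, x)) =
        (W (j + 1) (t, x) * M (j + 2) (t, x) - W (j + 2) (t, x) * M (j + 1) (t, x)) -
          (1 / 𝒯) * (M j (t, x) - κ₀ * H j (t, x))) :
    (∫ x in Ω, energyDensity jmom μ₀ U W M H (T, x)) +
      (∫ s in (0 : ℝ)..T, ∫ x in Ω, dissipationDensity T Ω ν νr c₁ c₂ μ₀ κ₀ 𝒯 U W M H (s, x)) ≤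
    (∫ s in (0 : ℝ)..T, ∫ x in Ω, forcingDensity T Ω μ₀ κ₀ 𝒯 A (s, x)) +
      ∫ x in Ω, energyDensity jmom μ₀ U W M H (0, x) := by
  have hU := uniqueDiffOn_cyl hT ho hc
  have he := contDiffOn_energyDensity (jmom := jmom) (μ₀ := μ₀) hUs hWs hMs hHs
  have hd := continuousOn_dissipationDensity (ν := ν) (νr := νr) (c₁ := c₁) (c₂ := c₂)
    (μ₀ := μ₀) (κ₀ := κ₀) (𝒯 := 𝒯) hU hUs hWs hMs hHs
  have hf := continuousOn_forcingDensity (μ₀ := μ₀) (κ₀ := κ₀) (𝒯 := 𝒯) hU hAs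
  refine energy_le_of_integral_le hT ho hb hU he hd hf fun t ht => ?_
  have ht' := Ioo_subset_Icc_self ht
  have hU0t := hU0 t ht'
  have hW0t := hW0 t ht'
  have hdivt := hdiv t ht'
  have hdU : ∀ i j, ContDiffOn ℝ (⊤ : ℕ∞) (dirD T Ω (dx i) (U j)) (cyl T Ω) :=
    fun i j => (hUs j).dirD hU _
  have hdW : ∀ i j, ContDiffOn ℝ (⊤ : ℕ∞) (dirD T Ω (dx i) (W j)) (cyl T Ω) :=
    fun i j => (hWs j).dirD hU _
  have hVs : ∀ j, ContDiffOn ℝ (⊤ : ℕ∞) (fun q => H j q - A j q + M j q) (cyl T Ω) :=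
    fun j => ((hHs j).sub (hAs j)).add (hMs j)
  have hpressure := zeroMean_convective ho hb hc hU hUs hPs ht' hU0t hdivt
  have hconvU := zeroMean_convective_sum_mul ho hb hc hU hUs hUs hUs ht' hU0t hdivt
  have hconvW := zeroMean_convective_sum_mul ho hb hc hU hUs hWs hWs ht' hU0t hdivt
  have hconvM := zeroMean_convective_sum_mul ho hb hc hU hUs hMs hMs ht' hU0t hdivt
  have hkelvin := zeroMean_convective_sum_mul ho hb hc hU hUs hMs hHs ht' hU0t hdivt
  have hlapU := zeroMean_sum_dirD_mul_add ho hb hc hU (ι := Fin 3 × Fin 3) (fun a => a.1)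
    (fun a => hUs a.2) (fun a => hdU a.1 a.2) ht' (fun a => hU0t a.2)
  have hlapW := zeroMean_sum_dirD_mul_add ho hb hc hU (ι := Fin 3 × Fin 3) (fun a => a.1)
    (fun a => hWs a.2) (fun a => hdW a.1 a.2) ht' (fun a => hW0t a.2)
  have hdivW := zeroMean_sum_dirD_mul_add ho hb hc hU (ι := Fin 3 × Fin 3) (fun a => a.2)
    (fun a => hWs a.2) (fun a => hdW a.1 a.1) ht' (fun a => hW0t a.2)
  have hcurl₁ := zeroMean_sum_dirD_mul_add ho hb hc hU (ι := Fin 3) (fun k => k + 1)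
    (fun k => hUs k) (fun k => hWs (k + 2)) ht' hU0t
  have hcurl₂ := zeroMean_sum_dirD_mul_add ho hb hc hU (ι := Fin 3) (fun k => k + 2)
    (fun k => hUs k) (fun k => hWs (k + 1)) ht' hU0t
  have hgrad₁ := zeroMean_sum_dirD_mul_add ho hb hc hU (ι := Fin 3 × Fin 3) (fun a => a.1)
    (fun a => hUs a.2) (fun a => hdU a.2 a.1) ht' (fun a => hU0t a.2)
  have hgrad₂ := zeroMean_sum_dirD_mul_add ho hb hc hU (ι := Fin 3 × Fin 3) (fun a => a.2)
    (fun a => hUs a.2) (fun a => hdU a.1 a.1) ht' (fun a => hU0t a.2)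
  have hpot : ZeroMean Ω fun x => ∑ j, (H j (t, x) - A j (t, x) + M j (t, x)) * H j (t, x) :=
    ⟨integrableOn_slice (F := fun q => ∑ j, (H j q - A j q + M j q) * H j q) hb
      (ContDiffOn.sum fun j _ => (hVs j).mul (hHs j)).continuousOn ht', horth t ht' t ht'⟩
  have hpot_t := zeroMean_sum_dt_mul ho hb hU hVs hHs ht fun s hs => horth s hs t ht'
  have hsum := (((((((((((((hpressure.const_mul (-1)).add (hconvU.const_mul (-(1 / 2)))).add
    (hconvW.const_mul (-(jmom / 2)))).add (hconvM.const_mul (-(μ₀ / 2)))).add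
    (hkelvin.const_mul μ₀)).add (hlapU.const_mul (ν + νr))).add (hlapW.const_mul c₁)).add
    (hdivW.const_mul c₂)).add (hcurl₁.const_mul (2 * νr))).add
    (hcurl₂.const_mul (-(2 * νr)))).add (hgrad₁.const_mul (-νr))).add
    (hgrad₂.const_mul νr)).add (hpot.const_mul (μ₀ * (1 + κ₀) / 𝒯))).add
    (hpot_t.const_mul μ₀)
  refine le_of_le_of_eq (setIntegral_mono_on ?_ hsum.1 ho.measurableSet fun x hx => ?_) hsum.2
  · exact integrableOn_slice (F := fun q => dirD T Ω dt (energyDensity jmom μ₀ U W M H) q +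
      dissipationDensity T Ω ν νr c₁ c₂ μ₀ κ₀ 𝒯 U W M H q - forcingDensity T Ω μ₀ κ₀ 𝒯 A q) hb
      (((he.dirD hU dt).continuousOn.add hd).sub hf) ht'
  have hq : ((t, x) : ℝ × E3) ∈ cyl T Ω := ⟨ht', subset_closure hx⟩
  have hsq : ∀ {F : Fin 3 → ℝ × E3 → ℝ}, (∀ j, ContDiffOn ℝ (⊤ : ℕ∞) (F j) (cyl T Ω)) →
      ContDiffOn ℝ (⊤ : ℕ∞) (fun q => ∑ j, F j q * F j q) (cyl T Ω) := fun hF =>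
    ContDiffOn.sum fun j _ => (hF j).mul (hF j)
  have hdsq : ∀ {F : Fin 3 → ℝ × E3 → ℝ}, (∀ j, ContDiffOn ℝ (⊤ : ℕ∞) (F j) (cyl T Ω)) →
      dirD T Ω dt (fun q => ∑ j, F j q * F j q) (t, x) =
        2 * ∑ j, dirD T Ω dt (F j) (t, x) * F j (t, x) := fun hF => by
    rw [dirD_sum_mul hU dt hF hF hq, Finset.mul_sum]
    exact Finset.sum_congr rfl fun j _ => by ring
  have hde : dirD T Ω dt (energyDensity jmom μ₀ U W M H) (t, x) =
      (∑ j, dirD T Ω dt (U j) (t, x) * U j (t, x)) +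
      jmom * (∑ j, dirD T Ω dt (W j) (t, x) * W j (t, x)) +
      μ₀ * (∑ j, dirD T Ω dt (M j) (t, x) * M j (t, x)) +
      μ₀ * (∑ j, dirD T Ω dt (H j) (t, x) * H j (t, x)) := by
    refine (dirD_energy hU dt (hsq hUs) (hsq hWs) (hsq hMs) (hsq hHs) jmom μ₀ hq).trans ?_
    rw [hdsq hUs, hdsq hWs, hdsq hMs, hdsq hHs]
    ring
  have hdV : ∀ j, dirD T Ω dt (fun q => H j q - A j q + M j q) (t, x) =
      dirD T Ω dt (H j) (t, x) - dirD T Ω dt (A j) (t, x) + dirD T Ω dt (M j) (t, x) :=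
    fun j => dirD_sub_add hU dt (hHs j) (hAs j) (hMs j) hq
  have key := energy_density_le hμ₀ hκ₀ h𝒯 (ν := ν) (νr := νr) (c₁ := c₁) (c₂ := c₂)
    (jmom := jmom) (u := fun j => U j (t, x)) (w := fun j => W j (t, x))
    (m := fun j => M j (t, x)) (h := fun j => H j (t, x))
    (ut := fun j => dirD T Ω dt (U j) (t, x)) (wt := fun j => dirD T Ω dt (W j) (t, x))
    (mt := fun j => dirD T Ω dt (M j) (t, x)) (dp := fun j => dirD T Ω (dx j) P (t, x))
    (du := fun i j => dirD T Ω (dx i) (U j) (t, x))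
    (dw := fun i j => dirD T Ω (dx i) (W j) (t, x))
    (dm := fun i j => dirD T Ω (dx i) (M j) (t, x))
    (dh := fun i j => dirD T Ω (dx i) (H j) (t, x))
    (ht := fun j => dirD T Ω dt (H j) (t, x)) (a := fun j => A j (t, x))
    (a_t := fun j => dirD T Ω dt (A j) (t, x))
    (d2u := fun i j k => dirD T Ω (dx i) (dirD T Ω (dx j) (U k)) (t, x))
    (d2w := fun i j k => dirD T Ω (dx i) (dirD T Ω (dx j) (W k)) (t, x))
    (hdivt x hx) (hsym t ht x hx)
    (fun i j k => dirD_comm ho (dx i) (dx j) (hUs k) ht hx)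
    (hlin t ht x hx) (hang t ht x hx) (hmag t ht x hx)
  simp only [hde, hdV, dissipationDensity, forcingDensity, Fintype.sum_prod_type]
  exact key

end EnergyEstimate

section Densities

variable {T : ℝ} {Ω : Set E3} {ν νr c₁ c₂ jmom μ₀ κ₀ 𝒯 : ℝ}
  {U W M H A : Fin 3 → ℝ × E3 → ℝ} {t : ℝ}

theorem integrableOn_sum_slice (hb : Bornology.IsBounded Ω) {ι : Type*} [Fintype ι]
    {F : ι → ℝ × E3 → ℝ} (hF : ∀ a, ContinuousOn (F a) (cyl T Ω)) (ht : t ∈ Icc 0 T) :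
    IntegrableOn (fun x => ∑ a, F a (t, x)) Ω :=
  integrable_finsetSum _ fun a _ => integrableOn_slice hb (hF a) ht

theorem integral_energyDensity (hb : Bornology.IsBounded Ω)
    (hU : ∀ j, ContinuousOn (U j) (cyl T Ω)) (hW : ∀ j, ContinuousOn (W j) (cyl T Ω))
    (hM : ∀ j, ContinuousOn (M j) (cyl T Ω)) (hH : ∀ j, ContinuousOn (H j) (cyl T Ω))
    (ht : t ∈ Icc 0 T) :
    ∫ x in Ω, energyDensity jmom μ₀ U W M H (t, x) =
      (1 / 2) * ((∫ x in Ω, ∑ j, U j (t, x) * U j (t, x)) +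
        jmom * (∫ x in Ω, ∑ j, W j (t, x) * W j (t, x)) +
        μ₀ * (∫ x in Ω, ∑ j, M j (t, x) * M j (t, x)) +
        μ₀ * (∫ x in Ω, ∑ j, H j (t, x) * H j (t, x))) := by
  have hsq : ∀ {F : Fin 3 → ℝ × E3 → ℝ}, (∀ j, ContinuousOn (F j) (cyl T Ω)) →
      Integrable (fun x => ∑ j, F j (t, x) * F j (t, x)) (volume.restrict Ω) := fun hF =>
    integrableOn_sum_slice hb (fun j => (hF j).mul (hF j)) ht
  have iU := hsq hU
  have iW := (hsq hW).const_mul jmom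
  have iM := (hsq hM).const_mul μ₀
  have iH := (hsq hH).const_mul μ₀
  simp only [energyDensity]
  rw [integral_const_mul, integral_add ((iU.fun_add iW).fun_add iM) iH,
    integral_add (iU.fun_add iW) iM, integral_add iU iW]
  simp only [integral_const_mul]

theorem integral_dissipationDensity (hb : Bornology.IsBounded Ω)
    (hK : UniqueDiffOn ℝ (cyl T Ω))
    (hU : ∀ j, ContDiffOn ℝ (⊤ : ℕ∞) (U j) (cyl T Ω))
    (hW : ∀ j, ContDiffOn ℝ (⊤ : ℕ∞) (W j) (cyl T Ω))
    (hM : ∀ j, ContinuousOn (M j) (cyl T Ω)) (hH : ∀ j, ContinuousOn (H j) (cyl T Ω))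
    (ht : t ∈ Icc 0 T) :
    ∫ x in Ω, dissipationDensity T Ω ν νr c₁ c₂ μ₀ κ₀ 𝒯 U W M H (t, x) =
      ν * (∫ x in Ω, ∑ i, ∑ j, dirD T Ω (dx i) (U j) (t, x) ^ 2) +
        c₁ * (∫ x in Ω, ∑ i, ∑ j, dirD T Ω (dx i) (W j) (t, x) ^ 2) +
        c₂ * (∫ x in Ω, (∑ i, dirD T Ω (dx i) (W i) (t, x)) ^ 2) +
        νr * (∫ x in Ω, ∑ j, (dirD T Ω (dx (j + 1)) (U (j + 2)) (t, x) -
          dirD T Ω (dx (j + 2)) (U (j + 1)) (t, x) - 2 * W j (t, x)) ^ 2) +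
        (μ₀ / 𝒯) * (∫ x in Ω, ∑ j, M j (t, x) * M j (t, x)) +
        (μ₀ / (2 * 𝒯)) * (1 / 2 + 3 * κ₀) * (∫ x in Ω, ∑ j, H j (t, x) * H j (t, x)) := by
  have hdU : ∀ i j, ContinuousOn (dirD T Ω (dx i) (U j)) (cyl T Ω) := fun i j =>
    ((hU j).dirD hK _).continuousOn
  have hdW : ∀ i j, ContinuousOn (dirD T Ω (dx i) (W j)) (cyl T Ω) := fun i j =>
    ((hW j).dirD hK _).continuousOn
  have hWc := fun j => (hW j).continuousOn
  have i₁ : Integrable (fun x => ν * ∑ i, ∑ j, dirD T Ω (dx i) (U j) (t, x) ^ 2)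
      (volume.restrict Ω) :=
    (integrableOn_slice (F := fun q => ∑ i, ∑ j, dirD T Ω (dx i) (U j) q ^ 2) hb
      (by fun_prop) ht).const_mul _
  have i₂ : Integrable (fun x => c₁ * ∑ i, ∑ j, dirD T Ω (dx i) (W j) (t, x) ^ 2)
      (volume.restrict Ω) :=
    (integrableOn_slice (F := fun q => ∑ i, ∑ j, dirD T Ω (dx i) (W j) q ^ 2) hb
      (by fun_prop) ht).const_mul _
  have i₃ : Integrable (fun x => c₂ * (∑ i, dirD T Ω (dx i) (W i) (t, x)) ^ 2)
      (volume.restrict Ω) :=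
    (integrableOn_slice (F := fun q => (∑ i, dirD T Ω (dx i) (W i) q) ^ 2) hb
      (by fun_prop) ht).const_mul _
  have i₄ : Integrable (fun x => νr * ∑ j, (dirD T Ω (dx (j + 1)) (U (j + 2)) (t, x) -
      dirD T Ω (dx (j + 2)) (U (j + 1)) (t, x) - 2 * W j (t, x)) ^ 2) (volume.restrict Ω) :=
    (integrableOn_slice (F := fun q => ∑ j, (dirD T Ω (dx (j + 1)) (U (j + 2)) q -
      dirD T Ω (dx (j + 2)) (U (j + 1)) q - 2 * W j q) ^ 2) hb (by fun_prop) ht).const_mul _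
  have i₅ : Integrable (fun x => (μ₀ / 𝒯) * ∑ j, M j (t, x) * M j (t, x))
      (volume.restrict Ω) :=
    (integrableOn_sum_slice hb (fun j => (hM j).mul (hM j)) ht).const_mul _
  have i₆ : Integrable (fun x => (μ₀ / (2 * 𝒯)) * (1 / 2 + 3 * κ₀) *
      ∑ j, H j (t, x) * H j (t, x)) (volume.restrict Ω) :=
    (integrableOn_sum_slice hb (fun j => (hH j).mul (hH j)) ht).const_mul _
  simp only [dissipationDensity]
  rw [integral_add ((((i₁.fun_add i₂).fun_add i₃).fun_add i₄).fun_add i₅) i₆,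
    integral_add (((i₁.fun_add i₂).fun_add i₃).fun_add i₄) i₅,
    integral_add ((i₁.fun_add i₂).fun_add i₃) i₄, integral_add (i₁.fun_add i₂) i₃,
    integral_add i₁ i₂]
  simp only [integral_const_mul]

theorem integral_forcingDensity (hb : Bornology.IsBounded Ω) (hK : UniqueDiffOn ℝ (cyl T Ω))
    (hA : ∀ j, ContDiffOn ℝ (⊤ : ℕ∞) (A j) (cyl T Ω)) (ht : t ∈ Icc 0 T) :
    ∫ x in Ω, forcingDensity T Ω μ₀ κ₀ 𝒯 A (t, x) =
      𝒯 * μ₀ * (∫ x in Ω, ∑ j, dirD T Ω dt (A j) (t, x) ^ 2) +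
        (μ₀ / (2 * 𝒯)) * (1 + κ₀) * (∫ x in Ω, ∑ j, A j (t, x) * A j (t, x)) := by
  have hAc := fun j => (hA j).continuousOn
  have i₁ : Integrable (fun x => 𝒯 * μ₀ * ∑ j, dirD T Ω dt (A j) (t, x) ^ 2)
      (volume.restrict Ω) :=
    (integrableOn_sum_slice hb (fun j => ((hA j).dirD hK dt).continuousOn.pow 2) ht).const_mul _
  have i₂ : Integrable (fun x => (μ₀ / (2 * 𝒯)) * (1 + κ₀) * ∑ j, A j (t, x) * A j (t, x))
      (volume.restrict Ω) :=
    (integrableOn_sum_slice hb (fun j => (hAc j).mul (hAc j)) ht).const_mul _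
  simp only [forcingDensity]
  rw [integral_add i₁ i₂]
  simp only [integral_const_mul]

theorem nsq_eq_integral_sum (ho : IsOpen Ω) {f : E3 → E3} {F : Fin 3 → E3 → ℝ}
    (h : ∀ x ∈ Ω, ∀ j, f x j = F j x) : nsq Ω f = ∫ x in Ω, ∑ j, F j x * F j x := by
  refine setIntegral_congr_fun ho.measurableSet fun x hx => ?_
  simp only [EuclideanSpace.real_norm_sq_eq, h x hx]
  exact Finset.sum_congr rfl fun j _ => pow_two _

theorem gradient_apply (f : E3 → ℝ) (x : E3) (j : Fin 3) : gradient f x j = pdS f j x := by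
  have h : ⟪gradient f x, EuclideanSpace.single j (1 : ℝ)⟫ = pdS f j x := by
    rw [gradient, InnerProductSpace.toDual_symm_apply, pdS]
  rw [← h, EuclideanSpace.inner_single_right]
  simp

theorem inner_gradient (v : E3) (f : E3 → ℝ) (x : E3) :
    ⟪v, gradient f x⟫ = ∑ j, v j * pdS f j x := by
  simp only [PiLp.inner_apply, gradient_apply]
  exact Finset.sum_congr rfl fun j _ => mul_comm _ _

/-- Spatial derivatives of a function that agrees on `Ω` with a time slice. -/
theorem pdS_eq_dirD (ho : IsOpen Ω) {F : ℝ × E3 → ℝ} {f : E3 → ℝ}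
    (hF : ContDiffOn ℝ (⊤ : ℕ∞) F (cyl T Ω)) (ht : t ∈ Icc 0 T)
    (h : ∀ y ∈ Ω, f y = F (t, y)) {x : E3} (hx : x ∈ Ω) (i : Fin 3) :
    pdS f i x = dirD T Ω (dx i) F (t, x) := by
  have he : f =ᶠ[𝓝 x] fun y => F (t, y) := eventually_of_mem (ho.mem_nhds hx) h
  rw [← pdS_slice ho hF ht hx i, pdS, pdS, he.fderiv_eq]

end Densities

/-- the formal energy estimate for the Rosensweig system with
σ = 0 coupled with the scalar-potential magnetostatics problem. -/
theorem stmt0 (Ω : Set E3)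
    (hΩopen : IsOpen Ω) (hΩbdd : Bornology.IsBounded Ω) (hΩconv : Convex ℝ Ω)
    (ν νr c₁ c₂ jmom μ₀ κ₀ 𝒯 : ℝ)
    (hν : 0 ≤ ν) (hνr : 0 ≤ νr) (hc₁ : 0 ≤ c₁) (hc₂ : 0 ≤ c₂) (hjmom : 0 ≤ jmom)
    (hμ₀ : 0 ≤ μ₀) (hκ₀ : 0 ≤ κ₀) (h𝒯 : 0 < 𝒯)
    (tF : ℝ) (htF : 0 < tF)
    (u w m : ℝ → E3 → E3) (p φ : ℝ → E3 → ℝ) (h_a : ℝ → E3 → E3)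
    -- smoothness on [0,tF] × cl(Ω)
    (hu : ContDiffOn ℝ (⊤ : ℕ∞) (fun q : ℝ × E3 => u q.1 q.2) (Icc 0 tF ×ˢ closure Ω))
    (hw : ContDiffOn ℝ (⊤ : ℕ∞) (fun q : ℝ × E3 => w q.1 q.2) (Icc 0 tF ×ˢ closure Ω))
    (hm : ContDiffOn ℝ (⊤ : ℕ∞) (fun q : ℝ × E3 => m q.1 q.2) (Icc 0 tF ×ˢ closure Ω))
    (hp : ContDiffOn ℝ (⊤ : ℕ∞) (fun q : ℝ × E3 => p q.1 q.2) (Icc 0 tF ×ˢ closure Ω))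
    (hφ : ContDiffOn ℝ (⊤ : ℕ∞) (fun q : ℝ × E3 => φ q.1 q.2) (Icc 0 tF ×ˢ closure Ω))
    (hha : ContDiffOn ℝ (⊤ : ℕ∞) (fun q : ℝ × E3 => h_a q.1 q.2) (Icc 0 tF ×ˢ closure Ω))
    -- (a) no-slip and no-spin boundary conditions
    (hbc : ∀ t ∈ Icc (0 : ℝ) tF, ∀ x ∈ frontier Ω, u t x = 0 ∧ w t x = 0)
    -- (b) incompressibility
    (hinc : ∀ t ∈ Icc (0 : ℝ) tF, ∀ x ∈ Ω, vdiv (u t) x = 0)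
    -- (c) the Rosensweig system with σ = 0, pointwise in (0,tF) × Ω, with
    -- effective field h = ∇φ; componentwise
    (hlin : ∀ t ∈ Ioo (0 : ℝ) tF, ∀ x ∈ Ω, ∀ j : Fin 3,
      deriv (fun s => u s x j) t + (∑ i, u t x i * pd (u t) i j x) -
          (ν + νr) * lapS (fun y => u t y j) x + pdS (p t) j x =
        2 * νr * ccomp (w t) j x +
          μ₀ * ∑ i, m t x i * pd (fun y => gradient (φ t) y) i j x)
    (hang : ∀ t ∈ Ioo (0 : ℝ) tF, ∀ x ∈ Ω, ∀ j : Fin 3,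
      jmom * deriv (fun s => w s x j) t + jmom * (∑ i, u t x i * pd (w t) i j x) -
          c₁ * lapS (fun y => w t y j) x -
          c₂ * pdS (fun y => vdiv (w t) y) j x + 4 * νr * w t x j =
        2 * νr * ccomp (u t) j x + μ₀ * crossc (m t x) (gradient (φ t) x) j)
    (hmag : ∀ t ∈ Ioo (0 : ℝ) tF, ∀ x ∈ Ω, ∀ j : Fin 3,
      deriv (fun s => m s x j) t + (∑ i, u t x i * pd (m t) i j x) =
        crossc (w t x) (m t x) j -
          (1 / 𝒯) * (m t x j - κ₀ * gradient (φ t) x j))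
    -- (d) the variational magnetostatics problem for the potential φ
    (hvar : ∀ t ∈ Icc (0 : ℝ) tF, ∀ χ : E3 → ℝ, ContDiff ℝ (⊤ : ℕ∞) χ →
      ipv Ω (fun x => gradient (φ t) x) (fun x => gradient χ x) =
        ipv Ω (fun x => h_a t x - m t x) (fun x => gradient χ x)) :
    -- the energy estimate 𝓔(tF) + ∫₀^{tF} 𝓓 ≤ ∫₀^{tF} 𝓕 + 𝓔(0)
    (1 / 2) * (nsq Ω (u tF) + jmom * nsq Ω (w tF) + μ₀ * nsq Ω (m tF) +
        μ₀ * nsq Ω (fun x => gradient (φ tF) x)) +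
      (∫ s in (0 : ℝ)..tF,
        (ν * gnsq Ω (u s) + c₁ * gnsq Ω (w s) +
          c₂ * (∫ x in Ω, (vdiv (w s) x) ^ 2) +
          νr * (∫ x in Ω, ∑ j, (ccomp (u s) j x - 2 * w s x j) ^ 2) +
          (μ₀ / 𝒯) * nsq Ω (m s) +
          (μ₀ / (2 * 𝒯)) * (1 / 2 + 3 * κ₀) *
            nsq Ω (fun x => gradient (φ s) x))) ≤
    (∫ s in (0 : ℝ)..tF,
        (𝒯 * μ₀ * (∫ x in Ω, ∑ j, (deriv (fun r => h_a r x j) s) ^ 2) +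
          (μ₀ / (2 * 𝒯)) * (1 + κ₀) * nsq Ω (h_a s))) +
      (1 / 2) * (nsq Ω (u 0) + jmom * nsq Ω (w 0) + μ₀ * nsq Ω (m 0) +
        μ₀ * nsq Ω (fun x => gradient (φ 0) x)) := by
  have hK := uniqueDiffOn_cyl htF hΩopen hΩconv
  let comp (f : ℝ → E3 → E3) (j : Fin 3) (q : ℝ × E3) : ℝ := f q.1 q.2 j
  let P (q : ℝ × E3) : ℝ := p q.1 q.2
  let Φ (q : ℝ × E3) : ℝ := φ q.1 q.2
  let H (j : Fin 3) : ℝ × E3 → ℝ := dirD tF Ω (dx j) Φ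
  have hUs : ∀ j, ContDiffOn ℝ (⊤ : ℕ∞) (comp u j) (cyl tF Ω) := contDiffOn_euclidean.1 hu
  have hWs : ∀ j, ContDiffOn ℝ (⊤ : ℕ∞) (comp w j) (cyl tF Ω) := contDiffOn_euclidean.1 hw
  have hMs : ∀ j, ContDiffOn ℝ (⊤ : ℕ∞) (comp m j) (cyl tF Ω) := contDiffOn_euclidean.1 hm
  have hAs : ∀ j, ContDiffOn ℝ (⊤ : ℕ∞) (comp h_a j) (cyl tF Ω) := contDiffOn_euclidean.1 hha
  have hPs : ContDiffOn ℝ (⊤ : ℕ∞) P (cyl tF Ω) := hp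
  have hΦs : ContDiffOn ℝ (⊤ : ℕ∞) Φ (cyl tF Ω) := hφ
  have hHs : ∀ j, ContDiffOn ℝ (⊤ : ℕ∞) (H j) (cyl tF Ω) := fun j => hΦs.dirD hK _
  have hpd : ∀ {f : ℝ → E3 → E3}, (∀ j, ContDiffOn ℝ (⊤ : ℕ∞) (comp f j) (cyl tF Ω)) →
      ∀ t ∈ Icc 0 tF, ∀ x ∈ Ω, ∀ i j,
        pd (f t) i j x = dirD tF Ω (dx i) (comp f j) (t, x) := fun hf t ht x hx i j =>
    pdS_eq_dirD hΩopen (hf j) ht (fun _ _ => rfl) hx i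
  have hlap : ∀ {f : ℝ → E3 → E3}, (∀ j, ContDiffOn ℝ (⊤ : ℕ∞) (comp f j) (cyl tF Ω)) →
      ∀ t ∈ Icc 0 tF, ∀ x ∈ Ω, ∀ j, lapS (fun y => f t y j) x =
        ∑ i, dirD tF Ω (dx i) (dirD tF Ω (dx i) (comp f j)) (t, x) := fun hf t ht x hx j =>
    Finset.sum_congr rfl fun i _ => pdS_eq_dirD hΩopen ((hf j).dirD hK _) ht
      (fun y hy => hpd hf t ht y hy i j) hx i
  have hgrad : ∀ t ∈ Icc 0 tF, ∀ x ∈ Ω, ∀ j, gradient (φ t) x j = H j (t, x) :=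
    fun t ht x hx j => (gradient_apply _ _ _).trans
      (pdS_eq_dirD hΩopen hΦs ht (fun _ _ => rfl) hx j)
  have hpdgrad : ∀ t ∈ Icc 0 tF, ∀ x ∈ Ω, ∀ i j,
      pd (fun y => gradient (φ t) y) i j x = dirD tF Ω (dx i) (H j) (t, x) :=
    fun t ht x hx i j => pdS_eq_dirD hΩopen (hHs j) ht (fun y hy => hgrad t ht y hy j) hx i
  have hgraddiv : ∀ t ∈ Icc 0 tF, ∀ x ∈ Ω, ∀ j, pdS (fun y => vdiv (w t) y) j x =
      ∑ i, dirD tF Ω (dx j) (dirD tF Ω (dx i) (comp w i)) (t, x) := fun t ht x hx j => by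
    rw [← dirD_sum hK (dx j) (fun i => (hWs i).dirD hK (dx i)) ⟨ht, subset_closure hx⟩]
    exact pdS_eq_dirD hΩopen (ContDiffOn.sum fun i _ => (hWs i).dirD hK (dx i)) ht
      (fun y hy => Finset.sum_congr rfl fun i _ => hpd hWs t ht y hy i i) hx j
  have hderiv : ∀ {f : ℝ → E3 → E3}, (∀ j, ContDiffOn ℝ (⊤ : ℕ∞) (comp f j) (cyl tF Ω)) →
      ∀ t ∈ Ioo 0 tF, ∀ x ∈ Ω, ∀ j,
        deriv (fun s => f s x j) t = dirD tF Ω dt (comp f j) (t, x) := fun hf t ht x hx j =>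
    (hasDerivAt_slice (hf j) ht (subset_closure hx)).deriv
  have horth : ∀ s ∈ Icc 0 tF, ∀ t ∈ Icc 0 tF,
      ∫ x in Ω, ∑ j, (H j (s, x) - comp h_a j (s, x) + comp m j (s, x)) * H j (t, x) = 0 := by
    intro s hs t ht
    have hV : ∀ j, ContinuousOn
        (fun x => H j (s, x) - comp h_a j (s, x) + comp m j (s, x)) (closure Ω) := fun j =>
      continuousOn_slice (((hHs j).sub (hAs j)).add (hMs j)).continuousOn hs
    have h0 := integral_mul_pdS_eq_zero hΩopen hΩbdd hΩconv hV (fun χ hχ => ?_)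
      (ψ := φ t) (hΦs.comp (f := fun y : E3 => (t, y)) (by fun_prop) fun y hy => ⟨ht, hy⟩)
    · rw [← h0]
      refine setIntegral_congr_fun hΩopen.measurableSet fun x hx =>
        Finset.sum_congr rfl fun j _ => ?_
      rw [← hgrad t ht x hx j, gradient_apply]
    · have hχc : ∀ j, Continuous (pdS χ j) := fun j =>
        (hχ.continuous_fderiv (by simp)).clm_apply continuous_const
      have hint : ∀ {F : Fin 3 → ℝ × E3 → ℝ}, (∀ j, ContDiffOn ℝ (⊤ : ℕ∞) (F j) (cyl tF Ω)) →
          Integrable (fun x => ∑ j, F j (s, x) * pdS χ j x) (volume.restrict Ω) := fun hF =>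
        integrableOn_sum_slice hΩbdd (fun j => (hF j).continuousOn.mul
          ((hχc j).comp continuous_snd).continuousOn) hs
      have h1 : ipv Ω (fun x => gradient (φ s) x) (fun x => gradient χ x) =
          ∫ x in Ω, ∑ j, H j (s, x) * pdS χ j x :=
        setIntegral_congr_fun hΩopen.measurableSet fun x hx => by
          simp only [inner_gradient, hgrad s hs x hx]
      have h2 : ipv Ω (fun x => h_a s x - m s x) (fun x => gradient χ x) =
          ∫ x in Ω, ∑ j, (comp h_a j (s, x) - comp m j (s, x)) * pdS χ j x :=
        setIntegral_congr_fun hΩopen.measurableSet fun x hx => by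
          simp only [inner_gradient, PiLp.sub_apply, comp]
      have h3 := hvar s hs χ hχ
      rw [h1, h2, ← sub_eq_zero, ← integral_sub (hint hHs)
        (hint (F := fun j q => comp h_a j q - comp m j q) fun j => (hAs j).sub (hMs j))] at h3
      rw [← h3]
      refine integral_congr_ae (Eventually.of_forall fun x => ?_)
      simp only [← Finset.sum_sub_distrib]
      exact Finset.sum_congr rfl fun j _ => by ring
  have key := energy_estimate_cyl (ν := ν) (νr := νr) (c₁ := c₁) (c₂ := c₂) (jmom := jmom)
    htF hΩopen hΩbdd hΩconv hμ₀ hκ₀ h𝒯 hUs hWs hMs hHs hAs hPs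
    (fun t ht j x hx => by simp only [comp, (hbc t ht x hx).1, PiLp.zero_apply])
    (fun t ht j x hx => by simp only [comp, (hbc t ht x hx).2, PiLp.zero_apply])
    (fun t ht x hx => by
      rw [← hinc t ht x hx, vdiv]
      exact Finset.sum_congr rfl fun i _ => (hpd hUs t ht x hx i i).symm)
    (fun t ht x hx i j => dirD_comm hΩopen (dx i) (dx j) hΦs ht hx) horth
    (fun t ht x hx j => by
      have ht' := Ioo_subset_Icc_self ht
      have h := hlin t ht x hx j
      simp only [ccomp, hderiv hUs t ht x hx, hpd hUs t ht' x hx, hpd hWs t ht' x hx,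
        hlap hUs t ht' x hx, hpdgrad t ht' x hx,
        pdS_eq_dirD hΩopen hPs ht' (f := p t) (fun _ _ => rfl) hx] at h
      exact h)
    (fun t ht x hx j => by
      have ht' := Ioo_subset_Icc_self ht
      have h := hang t ht x hx j
      simp only [ccomp, crossc, hderiv hWs t ht x hx, hpd hUs t ht' x hx, hpd hWs t ht' x hx,
        hlap hWs t ht' x hx, hgraddiv t ht' x hx, hgrad t ht' x hx] at h
      exact h)
    (fun t ht x hx j => by
      have ht' := Ioo_subset_Icc_self ht
      have h := hmag t ht x hx j
      simp only [crossc, hderiv hMs t ht x hx, hpd hMs t ht' x hx, hgrad t ht' x hx] at h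
      exact h)
  have hnsq : ∀ (f : ℝ → E3 → E3) t,
      nsq Ω (f t) = ∫ x in Ω, ∑ j, comp f j (t, x) * comp f j (t, x) := fun f t =>
    nsq_eq_integral_sum hΩopen fun _ _ _ => rfl
  have hnsqgrad : ∀ t ∈ Icc 0 tF,
      nsq Ω (fun x => gradient (φ t) x) = ∫ x in Ω, ∑ j, H j (t, x) * H j (t, x) :=
    fun t ht => nsq_eq_integral_sum hΩopen (hgrad t ht)
  have hgnsq : ∀ {f : ℝ → E3 → E3}, (∀ j, ContDiffOn ℝ (⊤ : ℕ∞) (comp f j) (cyl tF Ω)) →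
      ∀ t ∈ Icc 0 tF, gnsq Ω (f t) =
        ∫ x in Ω, ∑ i, ∑ j, dirD tF Ω (dx i) (comp f j) (t, x) ^ 2 := fun hf t ht =>
    setIntegral_congr_fun hΩopen.measurableSet fun x hx => by
      simp only [hpd hf t ht x hx]
  have hUc := fun j => (hUs j).continuousOn
  have hWc := fun j => (hWs j).continuousOn
  have hMc := fun j => (hMs j).continuousOn
  have hHc := fun j => (hHs j).continuousOn
  have hE : ∀ t ∈ Icc 0 tF, (1 / 2) * (nsq Ω (u t) + jmom * nsq Ω (w t) + μ₀ * nsq Ω (m t) +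
      μ₀ * nsq Ω (fun x => gradient (φ t) x)) =
      ∫ x in Ω, energyDensity jmom μ₀ (comp u) (comp w) (comp m) H (t, x) := fun t ht => by
    rw [integral_energyDensity hΩbdd hUc hWc hMc hHc ht, hnsq u, hnsq w, hnsq m, hnsqgrad t ht]
  rw [hE tF (right_mem_Icc.2 htF.le), hE 0 (left_mem_Icc.2 htF.le)]
  refine le_of_eq_of_le ?_ (key.trans_eq ?_)
  · congr 1
    refine intervalIntegral.integral_congr fun s hs => ?_
    rw [uIcc_of_le htF.le] at hs
    have hdivsq : ∫ x in Ω, vdiv (w s) x ^ 2 =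
        ∫ x in Ω, (∑ i, dirD tF Ω (dx i) (comp w i) (s, x)) ^ 2 :=
      setIntegral_congr_fun hΩopen.measurableSet fun x hx => by
        simp only [vdiv, hpd hWs s hs x hx]
    have hcurlsq : ∫ x in Ω, ∑ j, (ccomp (u s) j x - 2 * w s x j) ^ 2 =
        ∫ x in Ω, ∑ j, (dirD tF Ω (dx (j + 1)) (comp u (j + 2)) (s, x) -
          dirD tF Ω (dx (j + 2)) (comp u (j + 1)) (s, x) - 2 * comp w j (s, x)) ^ 2 :=
      setIntegral_congr_fun hΩopen.measurableSet fun x hx => by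
        simp only [ccomp, hpd hUs s hs x hx, comp]
    simp only [integral_dissipationDensity hΩbdd hK hUs hWs hMc hHc hs, hgnsq hUs s hs,
      hgnsq hWs s hs, hdivsq, hcurlsq, hnsq m, hnsqgrad s hs]
  · congr 1
    rw [intervalIntegral.integral_of_le htF.le, intervalIntegral.integral_of_le htF.le,
      integral_Ioc_eq_integral_Ioo, integral_Ioc_eq_integral_Ioo]
    refine setIntegral_congr_fun measurableSet_Ioo fun s hs => ?_
    have hdt : ∫ x in Ω, ∑ j, deriv (fun r => h_a r x j) s ^ 2 =
        ∫ x in Ω, ∑ j, dirD tF Ω dt (comp h_a j) (s, x) ^ 2 :=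
      setIntegral_congr_fun hΩopen.measurableSet fun x hx => by
        simp only [hderiv hAs s hs x hx]
    simp only [integral_forcingDensity hΩbdd hK hAs (Ioo_subset_Icc_self hs), hdt, hnsq h_a]
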